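/- Let n ≥ 2 and let f be a homogeneous cubic polynomial on ℝⁿ satisfying the eiconal equation |∇f(x)|² = 9|x|⁴ for all x ∈ ℝⁿ. Then either f is rotationally equivalent to the polynomial xₙ³ − 3xₙ(x₁² + … + x_{n−1}²), or n ∈ {5, 8, 14, 26} and f is harmonic (Δf = 0). -/

import Mathlib

/-!
# Homogeneous cubic solutions of the eiconal equation

A homogeneous cubic `f` on `ℝⁿ` induces a commutative product with `⟪x ∘ x, x⟫ = f x`, and the
eiconal equation becomes `|x ∘ x|² = |x|⁴`.  The Peirce decomposition with respect to an idempotent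
yields a Clifford system, whose existence restricts the dimension.
-/

open scoped InnerProductSpace

theorem two_mul_finrank_eigenspace_of_anticomm {V : Type*} [AddCommGroup V] [Module ℂ V]
    [FiniteDimensional ℂ V] {P A : Module.End ℂ V} (hP : P * P = 1) (hA : A * A = 1)
    (hPA : P * A = -(A * P)) :
    Module.finrank ℂ V = 2 * Module.finrank ℂ (Module.End.eigenspace P 1) := by
  have ht : LinearMap.trace ℂ V P = 0 := by
    have h1 : LinearMap.trace ℂ V (A * (P * A)) = LinearMap.trace ℂ V P := by
      rw [LinearMap.trace_mul_comm, mul_assoc, hA, mul_one]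
    rw [hPA, mul_neg, ← mul_assoc, hA, one_mul, map_neg] at h1
    linear_combination (-1 / 2) * h1
  have hp : LinearMap.IsProj (Module.End.eigenspace P 1) ((1 / 2 : ℂ) • (1 + P)) := by
    refine ⟨fun x => ?_, fun x hx => ?_⟩
    · have hx : P (P x) = x := by rw [← Module.End.mul_apply, hP, Module.End.one_apply]
      rw [Module.End.mem_eigenspace_iff]
      simp only [LinearMap.smul_apply, LinearMap.add_apply, Module.End.one_apply, map_smul,
        map_add, hx]
      module
    · rw [Module.End.mem_eigenspace_iff] at hx
      simp only [LinearMap.smul_apply, LinearMap.add_apply, Module.End.one_apply, hx]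
      module
  have h := hp.trace
  simp only [map_smul, map_add, LinearMap.trace_one, ht, smul_eq_mul] at h
  have : (Module.finrank ℂ V : ℂ) = 2 * Module.finrank ℂ (Module.End.eigenspace P 1) := by
    linear_combination 2 * h
  exact_mod_cast this

/-- A complex vector space carrying `2 * l`, or more, pairwise anticommuting involutions has
dimension divisible by `2 ^ l`. -/
theorem two_pow_dvd_finrank_of_anticomm (l : ℕ) (V : Type*) [AddCommGroup V] [Module ℂ V]
    [FiniteDimensional ℂ V] (A : ℕ → Module.End ℂ V) (hA : ∀ i < 2 * l, A i * A i = 1)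
    (hAB : ∀ i j, i < 2 * l → j < 2 * l → i ≠ j → A i * A j = -(A j * A i)) :
    2 ^ l ∣ Module.finrank ℂ V := by
  induction l generalizing V with
  | zero => simp
  | succ l ih =>
    set P := Complex.I • (A 0 * A 1) with hPdef
    have h0 := hA 0 (by omega)
    have h1 := hA 1 (by omega)
    have h01 := hAB 0 1 (by omega) (by omega) (by omega)
    have hP : P * P = 1 := by
      rw [hPdef, smul_mul_smul_comm, Complex.I_mul_I, mul_assoc, ← mul_assoc (A 1),
        hAB 1 0 (by omega) (by omega) (by omega), neg_mul, mul_assoc, h1, mul_one, mul_neg, h0]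
      simp
    have hPA : P * A 0 = -(A 0 * P) := by
      rw [hPdef, smul_mul_assoc, mul_smul_comm, mul_assoc,
        hAB 1 0 (by omega) (by omega) (by omega), mul_neg, smul_neg]
    have hcomm : ∀ i, i < 2 * l → A (i + 2) * P = P * A (i + 2) := by
      intro i hi
      rw [hPdef, smul_mul_assoc, mul_smul_comm, ← mul_assoc,
        hAB (i + 2) 0 (by omega) (by omega) (by omega), neg_mul, mul_assoc,
        hAB (i + 2) 1 (by omega) (by omega) (by omega), mul_neg, neg_neg, mul_assoc]
    rw [two_mul_finrank_eigenspace_of_anticomm hP h0 hPA, pow_succ']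
    refine mul_dvd_mul_left 2 ?_
    have hmaps : ∀ i, i < 2 * l → ∀ x ∈ Module.End.eigenspace P 1,
        A (i + 2) x ∈ Module.End.eigenspace P 1 := by
      intro i hi x hx
      rw [Module.End.mem_eigenspace_iff] at hx ⊢
      rw [← Module.End.mul_apply, ← hcomm i hi, Module.End.mul_apply, hx, map_smul]
    refine ih (Module.End.eigenspace P 1)
      (fun i => if hi : i < 2 * l then (A (i + 2)).restrict (hmaps i hi) else 0)
      (fun i hi => ?_) (fun i j hi hj hij => ?_)
    · ext x
      simp only [dif_pos hi, Module.End.mul_apply, LinearMap.coe_restrict_apply]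
      rw [← Module.End.mul_apply, hA (i + 2) (by omega)]
      rfl
    · ext x
      simp only [dif_pos hi, dif_pos hj, Module.End.mul_apply, LinearMap.coe_restrict_apply,
        LinearMap.neg_apply, Submodule.coe_neg]
      rw [← Module.End.mul_apply, hAB (i + 2) (j + 2) (by omega) (by omega) (by omega)]
      rfl

theorem mem_of_two_pow_dvd {m n r : ℕ} (h₁ : 3 * m + 4 = 2 * n) (h₂ : 3 * r = n + 1) (hm : 0 < m)
    (h : 2 ^ (r / 2) ∣ m) : n ∈ ({5, 8, 14, 26} : Set ℕ) := by
  obtain ⟨l, hl | hl⟩ : ∃ l, r = 2 * l ∨ r = 2 * l + 1 := ⟨r / 2, by omega⟩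
  · have hdiv : r / 2 = l := by omega
    rw [hdiv] at h
    have hl2 : l < 2 := by
      by_contra! hcon
      have : 2 ^ 2 ∣ m := (pow_dvd_pow 2 hcon).trans h
      omega
    simp only [Set.mem_insert_iff, Set.mem_singleton_iff]
    omega
  · have hdiv : r / 2 = l := by omega
    rw [hdiv] at h
    have hle : 2 ^ l ≤ 4 * l := (Nat.le_of_dvd hm h).trans (by omega)
    have hl5 : l < 5 := by
      by_contra! hcon
      have : ∀ k, 5 ≤ k → 4 * k < 2 ^ k := by
        intro k hk
        induction k, hk using Nat.le_induction with
        | base => norm_num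
        | succ k hk ih => rw [pow_succ]; omega
      exact absurd hle (this l hcon).not_ge
    have hm' : m = 4 * l := by omega
    have hn : n = 6 * l + 2 := by omega
    subst hm' hn
    interval_cases l <;> simp at *


/-- A commutative product `x ∘ y = M x y` with `⟪x ∘ y, z⟫` symmetric and `|x ∘ x|² = |x|⁴`. -/
structure IsEiconalProduct {E : Type*} [NormedAddCommGroup E] [InnerProductSpace ℝ E]
    (M : E →ₗ[ℝ] E →ₗ[ℝ] E) : Prop where
  comm : ∀ x y, M x y = M y x
  symm : ∀ x y z, ⟪M x y, z⟫_ℝ = ⟪y, M x z⟫_ℝ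
  inner_sq : ∀ x, ⟪M x x, M x x⟫_ℝ = ⟪x, x⟫_ℝ ^ 2

namespace IsEiconalProduct
variable {E : Type*} [NormedAddCommGroup E] [InnerProductSpace ℝ E] {M : E →ₗ[ℝ] E →ₗ[ℝ] E}

theorem inner_rotate (h : IsEiconalProduct M) (x y z : E) : ⟪M x y, z⟫_ℝ = ⟪M y z, x⟫_ℝ := by
  rw [h.comm x y, h.symm, real_inner_comm, h.comm y z, h.comm z y]

theorem mul_sq (h : IsEiconalProduct M) (x : E) : M x (M x x) = ⟪x, x⟫_ℝ • x := by
  refine ext_inner_right ℝ fun y => ?_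
  have key : ∀ t : ℝ, ⟪M x x, M x x⟫_ℝ + 4 * t * ⟪M x x, M x y⟫_ℝ
      + t ^ 2 * (2 * ⟪M x x, M y y⟫_ℝ + 4 * ⟪M x y, M x y⟫_ℝ) + 4 * t ^ 3 * ⟪M x y, M y y⟫_ℝ
      + t ^ 4 * ⟪M y y, M y y⟫_ℝ = (⟪x, x⟫_ℝ + 2 * t * ⟪x, y⟫_ℝ + t ^ 2 * ⟪y, y⟫_ℝ) ^ 2 := by
    intro t
    have := h.inner_sq (x + t • y)
    simp only [map_add, map_smul, LinearMap.add_apply, LinearMap.smul_apply, inner_add_left,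
      inner_add_right, real_inner_smul_left, real_inner_smul_right, h.comm y x,
      real_inner_comm (M x x) (M x y), real_inner_comm (M x x) (M y y),
      real_inner_comm (M x y) (M y y), real_inner_comm x y] at this
    linear_combination this
  rw [h.symm, real_inner_smul_left]
  linarith [key 1, key (-1), key 2, key (-2)]

theorem two_mul_mul_add (h : IsEiconalProduct M) (x y : E) :
    (2 : ℝ) • M x (M x y) + M y (M x x) = (2 * ⟪x, y⟫_ℝ) • x + ⟪x, x⟫_ℝ • y := by
  have h1 := h.mul_sq (x + y)
  have h2 := h.mul_sq (x - y)
  have h3 := h.mul_sq y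
  simp only [map_add, map_sub, LinearMap.add_apply, LinearMap.sub_apply, inner_add_left,
    inner_add_right, inner_sub_left, inner_sub_right, h.comm y x, real_inner_comm x y] at h1 h2
  linear_combination (norm := module) (1 / 2 : ℝ) • h1 - (1 / 2 : ℝ) • h2 - h3

theorem mul_mul_cyclic (h : IsEiconalProduct M) (x y z : E) :
    M x (M y z) + M y (M x z) + M z (M x y) =
      ⟪x, y⟫_ℝ • z + ⟪y, z⟫_ℝ • x + ⟪x, z⟫_ℝ • y := by
  have h1 := h.two_mul_mul_add (x + y) z
  have h2 := h.two_mul_mul_add x z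
  have h3 := h.two_mul_mul_add y z
  simp only [map_add, LinearMap.add_apply, inner_add_left,
    inner_add_right, h.comm y x, real_inner_comm x y] at h1
  linear_combination (norm := module) (1 / 2 : ℝ) • h1 - (1 / 2 : ℝ) • h2 - (1 / 2 : ℝ) • h3

section Trace
variable [FiniteDimensional ℝ E]

theorem trace_mul_smulRight_inner (A : E →ₗ[ℝ] E) (x y : E) :
    LinearMap.trace ℝ E (A * (innerₗ E x).smulRight y) = ⟪x, A y⟫_ℝ := by
  have : A * (innerₗ E x).smulRight y = (innerₗ E x).smulRight (A y) := by
    ext z; simp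
  rw [this, LinearMap.trace_smulRight, innerₗ_apply_apply]

omit [FiniteDimensional ℝ E] in
theorem mul_add_mul_add (h : IsEiconalProduct M) (x y : E) :
    M x * M y + M y * M x + M (M x y) = (innerₗ E x).smulRight y + (innerₗ E y).smulRight x
      + ⟪x, y⟫_ℝ • (1 : E →ₗ[ℝ] E) := by
  ext z
  have := h.mul_mul_cyclic x y z
  rw [h.comm z] at this
  simp only [LinearMap.add_apply, Module.End.mul_apply, LinearMap.smulRight_apply,
    innerₗ_apply_apply, LinearMap.smul_apply, Module.End.one_apply]
  linear_combination (norm := module) this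

theorem two_mul_trace_mul (h : IsEiconalProduct M) (x y : E) :
    2 * LinearMap.trace ℝ E (M x * M y) + LinearMap.trace ℝ E (M (M x y)) =
      (Module.finrank ℝ E + 2) * ⟪x, y⟫_ℝ := by
  have := congrArg (LinearMap.trace ℝ E) (h.mul_add_mul_add x y)
  simp only [map_add, map_smul, LinearMap.trace_smulRight, innerₗ_apply_apply,
    LinearMap.trace_one, smul_eq_mul, LinearMap.trace_mul_comm ℝ (M y), real_inner_comm x y] at this
  linear_combination this

theorem trace_mul_mul (h : IsEiconalProduct M) (x y z : E) :
    LinearMap.trace ℝ E (M (M z (M x y))) = ⟪y, z⟫_ℝ * LinearMap.trace ℝ E (M x)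
      + ⟪x, z⟫_ℝ * LinearMap.trace ℝ E (M y) - ⟪x, y⟫_ℝ * LinearMap.trace ℝ E (M z) := by
  have key : ∀ x y z, LinearMap.trace ℝ E (M z * (M x * M y)) +
      LinearMap.trace ℝ E (M z * (M y * M x)) + LinearMap.trace ℝ E (M z * M (M x y)) =
      2 * ⟪M x y, z⟫_ℝ + ⟪x, y⟫_ℝ * LinearMap.trace ℝ E (M z) := by
    intro x y z
    have := congrArg (fun A => LinearMap.trace ℝ E (M z * A)) (h.mul_add_mul_add x y)
    simp only [mul_add, map_add, map_smul, trace_mul_smulRight_inner, mul_smul_comm, mul_one,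
      smul_eq_mul] at this
    have e1 : ⟪x, M z y⟫_ℝ = ⟪M x y, z⟫_ℝ := by
      rw [h.inner_rotate, real_inner_comm, h.comm]
    have e2 : ⟪y, M z x⟫_ℝ = ⟪M x y, z⟫_ℝ := by
      rw [← h.inner_rotate, real_inner_comm]
    rw [e1, e2] at this
    linear_combination this
  have cyc : ∀ A B C : E →ₗ[ℝ] E, LinearMap.trace ℝ E (A * (B * C)) =
      LinearMap.trace ℝ E (B * (C * A)) := by
    intro A B C
    rw [LinearMap.trace_mul_comm, mul_assoc]
  have hs : ∀ x y z, 2 * ⟪x, y⟫_ℝ * LinearMap.trace ℝ E (M z)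
      + LinearMap.trace ℝ E (M (M z (M x y))) = 2 * ⟪y, z⟫_ℝ * LinearMap.trace ℝ E (M x)
      + LinearMap.trace ℝ E (M (M x (M y z))) := by
    intro x y z
    have k1 := key x y z
    have k2 := key y z x
    have q1 := h.two_mul_trace_mul z (M x y)
    have q2 := h.two_mul_trace_mul x (M y z)
    rw [cyc (M z) (M x), cyc (M z) (M y), cyc (M y) (M x)] at k1
    rw [← h.inner_rotate] at k2
    rw [real_inner_comm] at q1
    rw [real_inner_comm, ← h.inner_rotate] at q2
    linear_combination (-2) * k1 + 2 * k2 + q1 - q2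
  have c := congrArg (fun w => LinearMap.trace ℝ E (M w)) (h.mul_mul_cyclic x y z)
  simp only [map_add, map_smul, smul_eq_mul] at c
  rw [h.comm x z] at c
  have h1 := hs x y z
  have h2 := hs y z x
  rw [real_inner_comm x z] at h2
  linear_combination (1 / 3) * c + (1 / 3) * h1 + (1 / 3) * (h1 + h2)

theorem exists_idempotent (h : IsEiconalProduct M) [Nontrivial E] :
    ∃ e, ⟪e, e⟫_ℝ = 1 ∧ M e e = e := by
  have hc : Continuous fun x : E => ⟪M x x, x⟫_ℝ := by
    have : Continuous fun x : E => M x x := by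
      have := (LinearMap.toContinuousLinearMap (LinearMap.toContinuousLinearMap.toLinearMap ∘ₗ M))
      have h2 : Continuous fun x : E => (LinearMap.toContinuousLinearMap
        (LinearMap.toContinuousLinearMap.toLinearMap ∘ₗ M) x) x := by fun_prop
      simpa using h2
    exact this.inner continuous_id
  obtain ⟨e, he, hmax⟩ := (isCompact_sphere (0 : E) 1).exists_isMaxOn
    ((NormedSpace.sphere_nonempty).2 zero_le_one) hc.continuousOn
  have hee : ⟪e, e⟫_ℝ = 1 := by
    rw [real_inner_self_eq_norm_sq, mem_sphere_zero_iff_norm.1 he, one_pow]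
  have horth : ∀ v, ⟪e, v⟫_ℝ = 0 → ⟪v, v⟫_ℝ = 1 → ⟪M e e, v⟫_ℝ = 0 := by
    intro v hv hvv
    have hm : IsLocalMax (fun θ : ℝ => Real.cos θ ^ 3 * ⟪M e e, e⟫_ℝ
        + 3 * Real.cos θ ^ 2 * Real.sin θ * ⟪M e e, v⟫_ℝ
        + 3 * Real.cos θ * Real.sin θ ^ 2 * ⟪M e v, v⟫_ℝ + Real.sin θ ^ 3 * ⟪M v v, v⟫_ℝ) 0 := by
      refine Filter.Eventually.of_forall fun θ => ?_
      have hmem : Real.cos θ • e + Real.sin θ • v ∈ Metric.sphere (0 : E) 1 := by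
        rw [mem_sphere_zero_iff_norm, ← sq_eq_sq₀ (norm_nonneg _) zero_le_one,
          ← real_inner_self_eq_norm_sq]
        simp only [inner_add_left, inner_add_right, real_inner_smul_left, real_inner_smul_right,
          hee, hv, hvv, real_inner_comm e v]
        linear_combination Real.sin_sq_add_cos_sq θ
      have := hmax hmem
      simp only [Set.mem_ofPred_eq, map_add, map_smul, LinearMap.add_apply, LinearMap.smul_apply,
        inner_add_left, inner_add_right, real_inner_smul_left, real_inner_smul_right,
        h.comm v e, h.symm e v e, real_inner_comm (M e e) v, h.inner_rotate v v e] at this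
      simp only [Real.cos_zero, Real.sin_zero]
      linarith
    have hd : HasDerivAt (fun θ : ℝ => Real.cos θ ^ 3 * ⟪M e e, e⟫_ℝ
        + 3 * Real.cos θ ^ 2 * Real.sin θ * ⟪M e e, v⟫_ℝ
        + 3 * Real.cos θ * Real.sin θ ^ 2 * ⟪M e v, v⟫_ℝ + Real.sin θ ^ 3 * ⟪M v v, v⟫_ℝ)
        (3 * ⟪M e e, v⟫_ℝ) 0 := by
      have c := Real.hasDerivAt_cos 0
      have s := Real.hasDerivAt_sin 0
      refine (((((c.pow 3).mul_const ⟪M e e, e⟫_ℝ).add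
        ((((c.pow 2).const_mul 3).mul s).mul_const ⟪M e e, v⟫_ℝ)).add
        (((c.const_mul 3).mul (s.pow 2)).mul_const ⟪M e v, v⟫_ℝ)).add
        ((s.pow 3).mul_const ⟪M v v, v⟫_ℝ)).congr_deriv ?_
      simp
    have := hm.hasDerivAt_eq_zero hd
    linarith
  have horth' : ∀ v, ⟪e, v⟫_ℝ = 0 → ⟪M e e, v⟫_ℝ = 0 := by
    intro v hv
    by_cases hv0 : v = 0
    · simp [hv0]
    have hn : ‖v‖ ≠ 0 := norm_ne_zero_iff.2 hv0
    have := horth (‖v‖⁻¹ • v) (by simp [real_inner_smul_right, hv])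
      (by rw [real_inner_smul_left, real_inner_smul_right, real_inner_self_eq_norm_sq]; field_simp)
    rw [real_inner_smul_right] at this
    exact (mul_eq_zero.1 this).resolve_left (inv_ne_zero hn)
  have hmul : M e e = ⟪M e e, e⟫_ℝ • e := by
    refine ext_inner_right ℝ fun w => ?_
    have := horth' (w - ⟪e, w⟫_ℝ • e) (by
      rw [inner_sub_right, real_inner_smul_right, hee, mul_one, sub_self])
    rw [inner_sub_right, real_inner_smul_right] at this
    rw [real_inner_smul_left]
    linarith
  have hsq := h.inner_sq e
  have hnn : -⟪M e e, e⟫_ℝ ≤ ⟪M e e, e⟫_ℝ := by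
    have := hmax (show -e ∈ Metric.sphere (0 : E) 1 by simpa using he)
    simpa using this
  have h1 : ⟪M e e, e⟫_ℝ = 1 := by
    rw [hmul, real_inner_smul_left, real_inner_smul_right, hee] at hsq
    nlinarith
  exact ⟨e, hee, by rw [hmul, h1, one_smul]⟩

end Trace

section Peirce
variable {e : E}

theorem mul_idempotent_apply (h : IsEiconalProduct M) (he : ⟪e, e⟫_ℝ = 1) (hee : M e e = e)
    (x : E) : (2 : ℝ) • M e (M e x) + M e x = (2 * ⟪e, x⟫_ℝ) • e + x := by
  have := h.two_mul_mul_add e x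
  rwa [hee, he, h.comm x, one_smul] at this

theorem inner_eq_zero_of_mul_eq_half (h : IsEiconalProduct M) (hee : M e e = e) {u : E}
    (hu : M e u = (1 / 2 : ℝ) • u) : ⟪e, u⟫_ℝ = 0 := by
  have := h.symm e e u
  rw [hee, hu, real_inner_smul_right] at this
  linarith

theorem inner_eq_zero_of_mul_eq_neg (h : IsEiconalProduct M) (hee : M e e = e) {v : E}
    (hv : M e v = -v) : ⟪e, v⟫_ℝ = 0 := by
  have := h.symm e e v
  rw [hee, hv, inner_neg_right] at this
  linarith

theorem inner_eq_zero_of_mul_eq_half_of_mul_eq_neg (h : IsEiconalProduct M) {u v : E}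
    (hu : M e u = (1 / 2 : ℝ) • u) (hv : M e v = -v) : ⟪u, v⟫_ℝ = 0 := by
  have := h.symm e u v
  rw [hu, hv, inner_neg_right, real_inner_smul_left] at this
  linarith

/-- The Peirce decomposition with respect to an idempotent of norm one. -/
theorem exists_peirce_decomposition (h : IsEiconalProduct M) (he : ⟪e, e⟫_ℝ = 1) (hee : M e e = e)
    (x : E) : ∃ u v, M e u = (1 / 2 : ℝ) • u ∧ M e v = -v ∧ x = ⟪e, x⟫_ℝ • e + u + v := by
  have hx := h.mul_idempotent_apply he hee x
  refine ⟨(2 / 3 : ℝ) • (M e x + x - (2 * ⟪e, x⟫_ℝ) • e),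
    (1 / 3 : ℝ) • (x + ⟪e, x⟫_ℝ • e - (2 : ℝ) • M e x), ?_, ?_, by module⟩
  · simp only [map_add, map_smul, map_sub, hee]
    linear_combination (norm := module) (1 / 3 : ℝ) • hx
  · simp only [map_add, map_smul, map_sub, hee]
    linear_combination (norm := module) (-1 / 3 : ℝ) • hx

theorem mul_eq_neg_inner_smul (h : IsEiconalProduct M) (he : ⟪e, e⟫_ℝ = 1) (hee : M e e = e)
    {v w : E} (hv : M e v = -v) (hw : M e w = -w) : M v w = (-⟪v, w⟫_ℝ) • e := by
  have h1 := h.mul_mul_cyclic e v w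
  have hev := h.inner_eq_zero_of_mul_eq_neg hee hv
  have hew := h.inner_eq_zero_of_mul_eq_neg hee hw
  rw [hv, hw, map_neg, map_neg, h.comm w v, hev, hew] at h1
  have h2 := h.mul_idempotent_apply he hee (M v w)
  have h3 : ⟪e, M v w⟫_ℝ = -⟪v, w⟫_ℝ := by
    rw [real_inner_comm, ← h.inner_rotate, hv, inner_neg_left]
  have h4 : M e (M v w) = (2 : ℝ) • M v w + ⟪v, w⟫_ℝ • e := by
    linear_combination (norm := module) h1
  rw [h3, h4, map_add, map_smul, map_smul, h4, hee] at h2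
  linear_combination (norm := module) (1 / 9 : ℝ) • h2

theorem mul_mul_eq_half (h : IsEiconalProduct M) (hee : M e e = e)
    {u v : E} (hu : M e u = (1 / 2 : ℝ) • u) (hv : M e v = -v) :
    M e (M v u) = (1 / 2 : ℝ) • M v u := by
  have h1 := h.mul_mul_cyclic e v u
  rw [hv, hu, map_neg, map_smul, h.comm u v, h.inner_eq_zero_of_mul_eq_half hee hu,
    h.inner_eq_zero_of_mul_eq_neg hee hv, real_inner_comm,
    h.inner_eq_zero_of_mul_eq_half_of_mul_eq_neg hu hv] at h1
  linear_combination (norm := module) h1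

theorem mul_mul_add_mul_mul (h : IsEiconalProduct M) (he : ⟪e, e⟫_ℝ = 1) (hee : M e e = e)
    {u v w : E} (hu : M e u = (1 / 2 : ℝ) • u) (hv : M e v = -v) (hw : M e w = -w) :
    M v (M w u) + M w (M v u) = (3 / 2 * ⟪v, w⟫_ℝ) • u := by
  have h1 := h.mul_mul_cyclic v w u
  rw [h.mul_eq_neg_inner_smul he hee hv hw, map_smul, h.comm u e, hu, real_inner_comm u w,
    real_inner_comm u v, h.inner_eq_zero_of_mul_eq_half_of_mul_eq_neg hu hv,
    h.inner_eq_zero_of_mul_eq_half_of_mul_eq_neg hu hw] at h1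
  linear_combination (norm := module) h1

theorem mul_self_eq (h : IsEiconalProduct M) (hee : M e e = e)
    {u : E} (hu : M e u = (1 / 2 : ℝ) • u) :
    M e (M u u - (1 / 2 * ⟪u, u⟫_ℝ) • e) = -(M u u - (1 / 2 * ⟪u, u⟫_ℝ) • e) := by
  have h1 := h.two_mul_mul_add u e
  rw [h.comm u e, hu, map_smul, real_inner_comm, h.inner_eq_zero_of_mul_eq_half hee hu] at h1
  rw [map_sub, map_smul, hee]
  linear_combination (norm := module) h1

theorem mul_eq_neg_of_forall_half_eq_zero (h : IsEiconalProduct M) (he : ⟪e, e⟫_ℝ = 1)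
    (hee : M e e = e) (hU : ∀ u, M e u = (1 / 2 : ℝ) • u → u = 0) {x : E} (hx : ⟪e, x⟫_ℝ = 0) :
    M e x = -x := by
  obtain ⟨u, v, hu, hv, hxuv⟩ := h.exists_peirce_decomposition he hee x
  rw [hx, hU u hu] at hxuv
  rw [hxuv]
  simpa using hv

/-- If the `(-1)`-eigenspace of an idempotent is a line, then another idempotent has no
`1/2`-eigenspace. -/
theorem exists_idempotent_of_line (h : IsEiconalProduct M) (he : ⟪e, e⟫_ℝ = 1) (hee : M e e = e)
    {v : E} (hv : M e v = -v) (hvv : ⟪v, v⟫_ℝ = 1)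
    (hline : ∀ w, M e w = -w → ∃ c : ℝ, w = c • v) :
    ∃ e', ⟪e', e'⟫_ℝ = 1 ∧ M e' e' = e' ∧ ∀ x, ⟪e', x⟫_ℝ = 0 → M e' x = -x := by
  have hev := h.inner_eq_zero_of_mul_eq_neg hee hv
  have hvve : M v v = -e := by
    rw [h.mul_eq_neg_inner_smul he hee hv hv, hvv, neg_one_smul]
  set s : ℝ := √3 / 2 with hs
  have hss : s * s = 3 / 4 := by
    rw [hs]; ring_nf; rw [Real.sq_sqrt (by norm_num)]; norm_num
  have heig : ∀ u, M e u = (1 / 2 : ℝ) • u → M v u = s • u ∨ M v u = -(s • u) := by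
    intro u hu
    have hq := h.mul_mul_add_mul_mul he hee hu hv hv
    obtain ⟨c, hc⟩ := hline _ (h.mul_self_eq hee hu)
    have heu := h.inner_eq_zero_of_mul_eq_half hee hu
    have huv := h.inner_eq_zero_of_mul_eq_half_of_mul_eq_neg hu hv
    have hmu : M u u = (1 / 2 * ⟪u, u⟫_ℝ) • e + c • v := by
      rw [← hc]; abel
    have hn := h.inner_sq u
    have hvu : ⟪M v u, u⟫_ℝ = c := by
      rw [h.inner_rotate, hmu, inner_add_left, real_inner_smul_left, real_inner_smul_left, hev,
        hvv]
      ring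
    simp only [hmu, inner_add_left, inner_add_right, real_inner_smul_left, real_inner_smul_right,
      he, hev, hvv, real_inner_comm e v] at hn
    have hvuvu : ⟪M v u, M v u⟫_ℝ = 3 / 4 * ⟪u, u⟫_ℝ := by
      have h1 : M v (M v u) = (3 / 4 : ℝ) • u := by
        rw [hvv] at hq
        linear_combination (norm := module) (1 / 2 : ℝ) • hq
      rw [h.symm, h1, real_inner_smul_right]
    have hc2 : (c - s * ⟪u, u⟫_ℝ) * (c + s * ⟪u, u⟫_ℝ) = 0 := by
      linear_combination hn - ⟪u, u⟫_ℝ ^ 2 * hss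
    rcases mul_eq_zero.1 hc2 with hc | hc
    · left
      rw [← sub_eq_zero, ← inner_self_eq_zero (𝕜 := ℝ)]
      simp only [inner_sub_left, inner_sub_right, real_inner_smul_left, real_inner_smul_right,
        hvuvu, real_inner_comm (M v u) u, hvu]
      linear_combination (-2 * s) * hc - ⟪u, u⟫_ℝ * hss
    · right
      rw [← sub_eq_zero, ← inner_self_eq_zero (𝕜 := ℝ)]
      simp only [inner_sub_left, inner_sub_right, real_inner_smul_left, real_inner_smul_right,
        inner_neg_left, inner_neg_right, hvuvu, real_inner_comm (M v u) u, hvu]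
      linear_combination (2 * s) * hc - ⟪u, u⟫_ℝ * hss
  obtain ⟨a, ha, hu⟩ : ∃ a : ℝ, a * a = 3 / 4 ∧
      ∀ u, M e u = (1 / 2 : ℝ) • u → M v u = -(a • u) := by
    by_cases hall : ∀ u, M e u = (1 / 2 : ℝ) • u → M v u = -(s • u)
    · exact ⟨s, hss, hall⟩
    push Not at hall
    obtain ⟨u₁, hu₁, hne⟩ := hall
    have h₁ := (heig u₁ hu₁).resolve_right hne
    refine ⟨-s, by linarith, fun u hu => ?_⟩
    rcases heig u hu with h₂ | h₂
    · rw [h₂]; module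
    have hu0 : u₁ ≠ 0 := by rintro rfl; simp at hne
    have hsum : M e (u₁ + u) = (1 / 2 : ℝ) • (u₁ + u) := by rw [map_add, hu₁, hu, smul_add]
    rcases heig _ hsum with h₃ | h₃
    · rw [map_add, h₁, h₂] at h₃
      have : (2 * s) • u = 0 := by linear_combination (norm := module) (-1 : ℝ) • h₃
      rw [smul_eq_zero] at this
      rw [this.resolve_left (by positivity)]; simp
    · rw [map_add, h₁, h₂] at h₃
      have : (2 * s) • u₁ = 0 := by linear_combination (norm := module) h₃
      rw [smul_eq_zero] at this
      exact absurd (this.resolve_left (by positivity)) hu0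
  refine ⟨(-1 / 2 : ℝ) • e + a • v, ?_, ?_, fun x hx => ?_⟩
  · simp only [inner_add_left, inner_add_right, real_inner_smul_left, real_inner_smul_right,
      he, hev, hvv, real_inner_comm e v]
    linear_combination ha
  · simp only [map_add, map_smul, LinearMap.add_apply, LinearMap.smul_apply, hee, hv, hvve,
      h.comm v e]
    have hae : (a * a) • e = (3 / 4 : ℝ) • e := by rw [ha]
    linear_combination (norm := module) (-1 : ℝ) • hae
  · obtain ⟨u, w, hu', hw, hxuw⟩ := h.exists_peirce_decomposition he hee x
    obtain ⟨c, rfl⟩ := hline w hw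
    have heu := h.inner_eq_zero_of_mul_eq_half hee hu'
    have huv := h.inner_eq_zero_of_mul_eq_half_of_mul_eq_neg hu' hv
    generalize ⟪e, x⟫_ℝ = d at hxuw
    rw [hxuw] at hx ⊢
    simp only [inner_add_left, inner_add_right, real_inner_smul_left, real_inner_smul_right,
      he, hev, hvv, real_inner_comm e v, heu, real_inner_comm u v, huv] at hx
    have hd : d = 2 * a * c := by linarith
    simp only [map_add, map_smul, LinearMap.add_apply, LinearMap.smul_apply, hee, hv, hvve,
      h.comm v e, hu', hu u hu', hd]
    have hav : (a * a) • v = (3 / 4 : ℝ) • v := by rw [ha]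
    have hau : (a * a) • u = (3 / 4 : ℝ) • u := by rw [ha]
    linear_combination (norm := module) (-2 * c) • hav - hau

end Peirce

section Harmonic
variable [FiniteDimensional ℝ E] {e : E}

theorem trace_eq_zero (h : IsEiconalProduct M) (he : ⟪e, e⟫_ℝ = 1) (hee : M e e = e)
    (hU : ∃ u, M e u = (1 / 2 : ℝ) • u ∧ u ≠ 0)
    (hV : ∀ v, M e v = -v → ∃ w, M e w = -w ∧ w ≠ 0 ∧ ⟪v, w⟫_ℝ = 0) (x : E) :
    LinearMap.trace ℝ E (M x) = 0 := by
  have htU : ∀ u, M e u = (1 / 2 : ℝ) • u → LinearMap.trace ℝ E (M u) = 0 := by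
    intro u hu
    have := h.trace_mul_mul e e u
    rw [hee, h.comm u e, hu, h.inner_eq_zero_of_mul_eq_half hee hu, he, map_smul, map_smul,
      smul_eq_mul] at this
    linarith
  have htV : ∀ v, M e v = -v → LinearMap.trace ℝ E (M v) = 0 := by
    intro v hv
    obtain ⟨w, hw, hw0, hvw⟩ := hV v hv
    have := h.trace_mul_mul w w v
    rw [h.mul_eq_neg_inner_smul he hee hw hw, map_smul, h.comm v e, hv, real_inner_comm v w, hvw,
      map_smul, map_smul, map_neg, map_neg, smul_eq_mul] at this
    have hww : ⟪w, w⟫_ℝ ≠ 0 := inner_self_ne_zero.2 hw0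
    refine (mul_eq_zero.1 (?_ : ⟪w, w⟫_ℝ * LinearMap.trace ℝ E (M v) = 0)).resolve_left hww
    linarith
  have hte : LinearMap.trace ℝ E (M e) = 0 := by
    obtain ⟨u, hu, hu0⟩ := hU
    have h1 := h.trace_mul_mul u u e
    have h2 := htV _ (h.mul_self_eq hee hu)
    have h3 : M e (M u u) = (⟪u, u⟫_ℝ) • e - M u u := by
      have := h.mul_self_eq hee hu
      rw [map_sub, map_smul, hee] at this
      linear_combination (norm := module) this
    rw [real_inner_comm, h.inner_eq_zero_of_mul_eq_half hee hu, h3] at h1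
    simp only [map_sub, map_smul, smul_eq_mul] at h1 h2
    have huu : ⟪u, u⟫_ℝ ≠ 0 := inner_self_ne_zero.2 hu0
    refine (mul_eq_zero.1 (?_ : ⟪u, u⟫_ℝ * LinearMap.trace ℝ E (M e) = 0)).resolve_left huu
    linarith
  obtain ⟨u, v, hu, hv, hx⟩ := h.exists_peirce_decomposition he hee x
  rw [hx]
  simp [hte, htU u hu, htV v hv]

theorem finrank_eigenspace_half (h : IsEiconalProduct M) (he : ⟪e, e⟫_ℝ = 1) (hee : M e e = e)
    (ht : LinearMap.trace ℝ E (M e) = 0) :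
    3 * (Module.finrank ℝ (Module.End.eigenspace (M e) (1 / 2)) : ℝ) =
      2 * (Module.finrank ℝ E - 2) := by
  have hp : LinearMap.IsProj (Module.End.eigenspace (M e) (1 / 2))
      ((2 / 3 : ℝ) • (M e + 1 - (2 : ℝ) • (innerₗ E e).smulRight e)) := by
    refine ⟨fun x => ?_, fun u hu => ?_⟩
    · rw [Module.End.mem_eigenspace_iff]
      simp only [LinearMap.smul_apply, LinearMap.add_apply, LinearMap.sub_apply,
        LinearMap.smulRight_apply, innerₗ_apply_apply, Module.End.one_apply, map_add, map_smul,
        map_sub, hee]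
      linear_combination (norm := module) (1 / 3 : ℝ) • h.mul_idempotent_apply he hee x
    · rw [Module.End.mem_eigenspace_iff] at hu
      simp only [LinearMap.smul_apply, LinearMap.add_apply, LinearMap.sub_apply,
        LinearMap.smulRight_apply, innerₗ_apply_apply, Module.End.one_apply, hu,
        h.inner_eq_zero_of_mul_eq_half hee hu]
      module
  have := hp.trace
  simp only [map_smul, map_add, map_sub, ht, LinearMap.trace_one, LinearMap.trace_smulRight,
    innerₗ_apply_apply, he, smul_eq_mul] at this
  linarith

theorem finrank_eigenspace_neg_one (h : IsEiconalProduct M) (he : ⟪e, e⟫_ℝ = 1) (hee : M e e = e)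
    (ht : LinearMap.trace ℝ E (M e) = 0) :
    3 * (Module.finrank ℝ (Module.End.eigenspace (M e) (-1)) : ℝ) = Module.finrank ℝ E + 1 := by
  have hp : LinearMap.IsProj (Module.End.eigenspace (M e) (-1))
      ((1 / 3 : ℝ) • (1 + (innerₗ E e).smulRight e - (2 : ℝ) • M e)) := by
    refine ⟨fun x => ?_, fun u hu => ?_⟩
    · rw [Module.End.mem_eigenspace_iff]
      simp only [LinearMap.smul_apply, LinearMap.add_apply, LinearMap.sub_apply,
        LinearMap.smulRight_apply, innerₗ_apply_apply, Module.End.one_apply, map_add, map_smul,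
        map_sub, hee]
      linear_combination (norm := module) (-1 / 3 : ℝ) • h.mul_idempotent_apply he hee x
    · rw [Module.End.mem_eigenspace_iff, neg_one_smul] at hu
      simp only [LinearMap.smul_apply, LinearMap.add_apply, LinearMap.sub_apply,
        LinearMap.smulRight_apply, innerₗ_apply_apply, Module.End.one_apply, hu,
        h.inner_eq_zero_of_mul_eq_neg hee hu]
      module
  have := hp.trace
  simp only [map_smul, map_add, map_sub, ht, LinearMap.trace_one, LinearMap.trace_smulRight,
    innerₗ_apply_apply, he, smul_eq_mul] at this
  linarith

theorem two_pow_dvd_finrank_eigenspace_half (h : IsEiconalProduct M) (he : ⟪e, e⟫_ℝ = 1)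
    (hee : M e e = e) : 2 ^ (Module.finrank ℝ (Module.End.eigenspace (M e) (-1)) / 2) ∣
      Module.finrank ℝ (Module.End.eigenspace (M e) (1 / 2)) := by
  set U := Module.End.eigenspace (M e) (1 / 2)
  set V := Module.End.eigenspace (M e) (-1)
  have hV : ∀ v : V, M e v = -(v : E) := fun v => by
    rw [Module.End.mem_eigenspace_iff.1 v.2, neg_one_smul]
  have hmaps : ∀ v : V, ∀ u ∈ U, M v u ∈ U := fun v u hu =>
    Module.End.mem_eigenspace_iff.2
      (h.mul_mul_eq_half hee (Module.End.mem_eigenspace_iff.1 hu) (hV v))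
  let S : V → Module.End ℝ U := fun v => (2 / √3) • (M v).restrict (hmaps v)
  have hS : ∀ v w, S v * S w + S w * S v = (2 * ⟪v, w⟫_ℝ) • 1 := by
    intro v w
    ext u
    have h3 : (2 / √3) * (2 / √3) = 4 / 3 := by
      rw [div_mul_div_comm, Real.mul_self_sqrt (by norm_num)]; norm_num
    have := h.mul_mul_add_mul_mul he hee (Module.End.mem_eigenspace_iff.1 u.2) (hV v) (hV w)
    simp only [S, smul_mul_smul_comm, h3, LinearMap.add_apply, LinearMap.smul_apply,
      Module.End.mul_apply, Submodule.coe_add, Submodule.coe_smul, LinearMap.coe_restrict_apply,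
      Module.End.one_apply, Submodule.coe_inner]
    linear_combination (norm := module) (4 / 3 : ℝ) • this
  let b := stdOrthonormalBasis ℝ V
  let A : ℕ → Module.End ℝ U := fun i => if hi : i < Module.finrank ℝ V then S (b ⟨i, hi⟩) else 0
  rw [← Module.finrank_baseChange (R := ℂ) (S := ℝ) (M' := U)]
  refine two_pow_dvd_finrank_of_anticomm _ _ (fun i => (A i).baseChange ℂ) (fun i hi => ?_)
    (fun i j hi hj hij => ?_)
  · have hi' : i < Module.finrank ℝ V := by omega
    have := hS (b ⟨i, hi'⟩) (b ⟨i, hi'⟩)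
    rw [b.inner_eq_one] at this
    have h1 : A i * A i = 1 := by
      simp only [A, dif_pos hi']
      linear_combination (norm := module) (1 / 2 : ℝ) • this
    rw [← LinearMap.baseChange_mul, h1, LinearMap.baseChange_one]
  · have hi' : i < Module.finrank ℝ V := by omega
    have hj' : j < Module.finrank ℝ V := by omega
    have := hS (b ⟨i, hi'⟩) (b ⟨j, hj'⟩)
    rw [b.inner_eq_zero (by simpa using hij)] at this
    have h1 : A i * A j = -(A j * A i) := by
      simp only [A, dif_pos hi', dif_pos hj']
      linear_combination (norm := module) this
    rw [← LinearMap.baseChange_mul, ← LinearMap.baseChange_mul, h1, LinearMap.baseChange_neg]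

end Harmonic

theorem reducible_or_harmonic [FiniteDimensional ℝ E] [Nontrivial E] (h : IsEiconalProduct M) :
    (∃ e, ⟪e, e⟫_ℝ = 1 ∧ M e e = e ∧ ∀ x, ⟪e, x⟫_ℝ = 0 → M e x = -x) ∨
      (Module.finrank ℝ E ∈ ({5, 8, 14, 26} : Set ℕ) ∧ ∀ x, LinearMap.trace ℝ E (M x) = 0) := by
  obtain ⟨e, he, hee⟩ := h.exists_idempotent
  by_cases hU : ∀ u, M e u = (1 / 2 : ℝ) • u → u = 0
  · exact .inl ⟨e, he, hee, fun x hx => h.mul_eq_neg_of_forall_half_eq_zero he hee hU hx⟩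
  push Not at hU
  by_cases hV : ∀ v, M e v = -v → ∃ w, M e w = -w ∧ w ≠ 0 ∧ ⟪v, w⟫_ℝ = 0
  · right
    have ht := h.trace_eq_zero he hee hU hV
    refine ⟨?_, ht⟩
    have h1 := h.finrank_eigenspace_half he hee (ht e)
    have h2 := h.finrank_eigenspace_neg_one he hee (ht e)
    have h3 := h.two_pow_dvd_finrank_eigenspace_half he hee
    obtain ⟨u, hu, hu0⟩ := hU
    have : Nontrivial (Module.End.eigenspace (M e) (1 / 2)) :=
      ⟨⟨u, Module.End.mem_eigenspace_iff.2 hu⟩, 0, by simpa using hu0⟩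
    have h4 : 0 < Module.finrank ℝ (Module.End.eigenspace (M e) (1 / 2)) := Module.finrank_pos
    generalize Module.finrank ℝ (Module.End.eigenspace (M e) (1 / 2)) = m at *
    generalize Module.finrank ℝ (Module.End.eigenspace (M e) (-1)) = r at *
    generalize Module.finrank ℝ E = n at *
    have h5 : 3 * m + 4 = 2 * n := by
      have : (3 * m + 4 : ℝ) = 2 * n := by linarith
      exact_mod_cast this
    have h6 : 3 * r = n + 1 := by exact_mod_cast h2
    exact mem_of_two_pow_dvd h5 h6 h4 h3
  · left
    push Not at hV
    obtain ⟨v, hv, hvV⟩ := hV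
    by_cases hv0 : v = 0
    · obtain ⟨u, hu, hu0⟩ := hU
      have h1 := not_imp_not.1 (hvV _ (h.mul_self_eq hee hu)) (by simp [hv0])
      have h2 := h.inner_sq u
      have huu : ⟪u, u⟫_ℝ ≠ 0 := inner_self_ne_zero.2 hu0
      rw [sub_eq_zero.1 h1, real_inner_smul_left, real_inner_smul_right, he] at h2
      exact absurd (by linarith : ⟪u, u⟫_ℝ ^ 2 = 0) (pow_ne_zero 2 huu)
    have hn : ‖v‖ ≠ 0 := norm_ne_zero_iff.2 hv0
    refine h.exists_idempotent_of_line he hee (v := ‖v‖⁻¹ • v) (by rw [map_smul, hv, smul_neg])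
      (by rw [real_inner_smul_left, real_inner_smul_right, real_inner_self_eq_norm_sq]; field_simp)
      fun w hw => ⟨‖v‖⁻¹ * ⟪v, w⟫_ℝ, ?_⟩
    rw [← sub_eq_zero]
    refine not_imp_not.1 (hvV _ ?_) ?_
    · simp only [map_sub, map_smul, hw, hv]; module
    · rw [inner_sub_right, real_inner_smul_right, real_inner_smul_right,
        real_inner_self_eq_norm_sq]
      field_simp
      simp

end IsEiconalProduct

open MvPolynomial

theorem MvPolynomial.IsHomogeneous.eval_smul {σ R : Type*} [CommSemiring R] {φ : MvPolynomial σ R}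
    {m : ℕ} (h : φ.IsHomogeneous m) (t : R) (x : σ → R) :
    eval (t • x) φ = t ^ m * eval x φ := by
  rw [eval_eq, eval_eq, Finset.mul_sum]
  refine Finset.sum_congr rfl fun d hd => ?_
  have hdeg : ∑ i ∈ d.support, d i = m := by
    rw [← Finsupp.degree_apply, ← h (mem_support_iff.1 hd)]
    exact DFunLike.congr_fun Finsupp.degree_eq_weight_one d
  simp only [Pi.smul_apply, smul_eq_mul, mul_pow, Finset.prod_mul_distrib,
    Finset.prod_pow_eq_pow_sum, hdeg]
  ring

theorem MvPolynomial.isHomogeneous_of_eval_smul {σ : Type*} {m : ℕ} {f : MvPolynomial σ ℝ}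
    (hf : ∀ (t : ℝ) (x : σ → ℝ), eval (t • x) f = t ^ m * eval x f) : f.IsHomogeneous m := by
  have hsum : ∑ i ∈ Finset.range (f.totalDegree + 1),
      C ((2 : ℝ) ^ i - 2 ^ m) * homogeneousComponent i f = 0 := by
    refine MvPolynomial.funext fun x => ?_
    have h1 := hf 2 x
    rw [← sum_homogeneousComponent f] at h1
    simp only [map_sum, (homogeneousComponent_isHomogeneous _ f).eval_smul, Finset.mul_sum] at h1
    simp only [map_sum, map_mul, eval_C, sub_mul, Finset.sum_sub_distrib, map_zero]
    rw [sub_eq_zero, h1]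
  have hcomp : ∀ j, j ≠ m → homogeneousComponent j f = 0 := by
    intro j hj
    by_cases hjd : f.totalDegree < j
    · exact homogeneousComponent_eq_zero _ _ hjd
    have h2 := congrArg (homogeneousComponent j) hsum
    rw [map_sum, map_zero, Finset.sum_eq_single j] at h2
    · rw [homogeneousComponent_C_mul, homogeneousComponent_eq_self
        (homogeneousComponent_isHomogeneous j f), mul_eq_zero, C_eq_zero, sub_eq_zero] at h2
      exact h2.resolve_left fun h => hj (pow_right_injective₀ two_pos (by norm_num) h)
    · intro i _ hij
      rw [homogeneousComponent_C_mul,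
        homogeneousComponent_of_mem (homogeneousComponent_isHomogeneous i f), if_neg hij.symm,
        mul_zero]
    · intro hj
      exact absurd (Finset.mem_range.2 (by omega)) hj
  rw [← sum_homogeneousComponent f]
  refine IsHomogeneous.sum _ _ _ fun i _ => ?_
  by_cases hi : i = m
  · exact hi ▸ homogeneousComponent_isHomogeneous i f
  · rw [hcomp i hi]; exact isHomogeneous_zero _ _ _

theorem MvPolynomial.pderiv_pderiv_comm {σ R : Type*} [CommRing R] (i j : σ)
    (f : MvPolynomial σ R) : pderiv i (pderiv j f) = pderiv j (pderiv i f) := by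
  classical
  have : ⁅pderiv (R := R) i, pderiv (R := R) j⁆ = 0 := by
    refine derivation_ext fun k => ?_
    rw [Derivation.commutator_apply, pderiv_X, pderiv_X, Pi.single_apply, Pi.single_apply]
    split_ifs <;> simp
  have := DFunLike.congr_fun this f
  rwa [Derivation.commutator_apply, Derivation.zero_apply, sub_eq_zero] at this

section CubicForm
variable {n : ℕ} (f : MvPolynomial (Fin n) ℝ)

/-- The third partial derivatives of a cubic polynomial. -/
noncomputable def thirdPartial (i j k : Fin n) : ℝ :=
  constantCoeff (pderiv i (pderiv j (pderiv k f)))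

theorem thirdPartial_swap_left (i j k : Fin n) : thirdPartial f i j k = thirdPartial f j i k := by
  rw [thirdPartial, pderiv_pderiv_comm, thirdPartial]

theorem thirdPartial_swap_right (i j k : Fin n) :
    thirdPartial f i j k = thirdPartial f i k j := by
  rw [thirdPartial, pderiv_pderiv_comm j k, thirdPartial]

/-- The commutative product `x ∘ y` on `ℝⁿ` such that `⟪x ∘ x, x⟫ = f x`. -/
noncomputable def cubicProduct :
    EuclideanSpace ℝ (Fin n) →ₗ[ℝ] EuclideanSpace ℝ (Fin n) →ₗ[ℝ] EuclideanSpace ℝ (Fin n) :=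
  LinearMap.mk₂ ℝ
    (fun x y => WithLp.toLp 2 fun k => 1 / 6 * ∑ i, ∑ j, thirdPartial f i j k * (x i * y j))
    (fun x y z => by
      ext k; simp only [PiLp.add_apply, add_mul, mul_add, Finset.sum_add_distrib])
    (fun c x y => by
      ext k
      simp only [PiLp.smul_apply, smul_eq_mul, Finset.mul_sum]
      exact Finset.sum_congr rfl fun i _ => Finset.sum_congr rfl fun j _ => by ring)
    (fun x y z => by
      ext k; simp only [PiLp.add_apply, mul_add, Finset.sum_add_distrib])
    (fun c x y => by
      ext k
      simp only [PiLp.smul_apply, smul_eq_mul, Finset.mul_sum]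
      exact Finset.sum_congr rfl fun i _ => Finset.sum_congr rfl fun j _ => by ring)

theorem cubicProduct_apply (x y : EuclideanSpace ℝ (Fin n)) (k : Fin n) :
    cubicProduct f x y k = 1 / 6 * ∑ i, ∑ j, thirdPartial f i j k * (x i * y j) := rfl

variable {f}

theorem sum_mul_eval_pderiv {m : ℕ} (h : f.IsHomogeneous m) (x : Fin n → ℝ) :
    ∑ i, x i * eval x (pderiv i f) = m * eval x f := by
  have := congrArg (eval x) h.sum_X_mul_pderiv
  simpa using this

theorem pderiv_pderiv_pderiv_eq (hf : f.IsHomogeneous 3) (i j k : Fin n) :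
    pderiv i (pderiv j (pderiv k f)) = C (thirdPartial f i j k) := by
  have h : (pderiv i (pderiv j (pderiv k f))).IsHomogeneous 0 := hf.pderiv.pderiv.pderiv
  rw [thirdPartial, constantCoeff_eq]
  exact totalDegree_eq_zero_iff_eq_C.1 ((totalDegree_zero_iff_isHomogeneous _).2 h)

theorem eval_pderiv_eq (hf : f.IsHomogeneous 3) (x : EuclideanSpace ℝ (Fin n)) (k : Fin n) :
    eval x (pderiv k f) = 3 * cubicProduct f x x k := by
  have h2 := sum_mul_eval_pderiv (hf.pderiv (i := k)) x
  have h1 : ∀ j, ∑ i, x i * eval x (pderiv i (pderiv j (pderiv k f))) =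
      eval x (pderiv j (pderiv k f)) := fun j => by
    simpa using sum_mul_eval_pderiv (hf.pderiv (i := k)).pderiv x
  simp only [← h1, pderiv_pderiv_pderiv_eq hf, eval_C, Finset.mul_sum] at h2
  rw [Finset.sum_comm] at h2
  rw [cubicProduct_apply]
  have h3 : ∑ i, ∑ j, thirdPartial f i j k * (x i * x j) =
      ∑ i, ∑ j, x j * (x i * thirdPartial f i j k) :=
    Finset.sum_congr rfl fun i _ => Finset.sum_congr rfl fun j _ => by ring
  rw [h3, h2]
  norm_num
  ring

theorem eval_eq_inner (hf : f.IsHomogeneous 3) (x : EuclideanSpace ℝ (Fin n)) :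
    eval x f = inner ℝ (cubicProduct f x x) x := by
  have h := sum_mul_eval_pderiv hf x
  simp only [eval_pderiv_eq hf] at h
  simp only [PiLp.inner_apply, Real.inner_apply]
  have h' : ∑ i, x i * (3 * cubicProduct f x x i) = 3 * ∑ i, cubicProduct f x x i * x i := by
    rw [Finset.mul_sum]
    exact Finset.sum_congr rfl fun i _ => by ring
  rw [h'] at h
  norm_num at h
  exact h.symm

theorem isEiconalProduct_cubicProduct (hf : f.IsHomogeneous 3)
    (heiconal : ∀ x : Fin n → ℝ,
      ∑ i, (eval x (pderiv i f)) ^ 2 = 9 * (∑ i, x i ^ 2) ^ 2) :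
    IsEiconalProduct (cubicProduct f) where
  comm x y := by
    ext k
    rw [cubicProduct_apply, cubicProduct_apply, Finset.sum_comm]
    simp only [thirdPartial_swap_left f _ _ k, mul_comm (x _)]
  symm x y z := by
    simp only [PiLp.inner_apply, Real.inner_apply, cubicProduct_apply, Finset.mul_sum,
      Finset.sum_mul]
    rw [Finset.sum_comm]
    conv_rhs => rw [Finset.sum_comm]
    refine Finset.sum_congr rfl fun i _ => ?_
    rw [Finset.sum_comm]
    refine Finset.sum_congr rfl fun j _ => Finset.sum_congr rfl fun k _ => ?_
    rw [thirdPartial_swap_right f i j k]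
    ring
  inner_sq x := by
    have h := heiconal x
    simp only [eval_pderiv_eq hf, mul_pow, ← Finset.mul_sum] at h
    simp only [PiLp.inner_apply, Real.inner_apply, ← pow_two]
    linarith

theorem sum_pderiv_pderiv_eq_zero (hf : f.IsHomogeneous 3)
    (ht : ∀ x, LinearMap.trace ℝ _ (cubicProduct f x) = 0) : ∑ i, pderiv i (pderiv i f) = 0 := by
  have hc : ∀ j, ∑ i, thirdPartial f j i i = 0 := by
    intro j
    have := ht (EuclideanSpace.single j 1)
    rw [LinearMap.trace_eq_sum_inner _ (EuclideanSpace.basisFun (Fin n) ℝ)] at this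
    simpa [EuclideanSpace.inner_single_left, cubicProduct_apply, ← Finset.mul_sum] using this
  have hh : (∑ i, pderiv i (pderiv i f)).IsHomogeneous 1 :=
    IsHomogeneous.sum _ _ _ fun i _ => hf.pderiv.pderiv
  have h := hh.sum_X_mul_pderiv
  simp only [map_sum, pderiv_pderiv_pderiv_eq hf, one_smul] at h
  rw [← h]
  refine Finset.sum_eq_zero fun j _ => ?_
  rw [← map_sum, hc, map_zero, mul_zero]

end CubicForm

theorem IsEiconalProduct.inner_mul_self_eq {E : Type*} [NormedAddCommGroup E]
    [InnerProductSpace ℝ E] {M : E →ₗ[ℝ] E →ₗ[ℝ] E} (h : IsEiconalProduct M) {e : E}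
    (he : ⟪e, e⟫_ℝ = 1) (hee : M e e = e) (hV : ∀ x, ⟪e, x⟫_ℝ = 0 → M e x = -x) (x : E) :
    ⟪M x x, x⟫_ℝ = ⟪e, x⟫_ℝ ^ 3 - 3 * ⟪e, x⟫_ℝ * (⟪x, x⟫_ℝ - ⟪e, x⟫_ℝ ^ 2) := by
  obtain ⟨y, hy⟩ : ∃ y, y = x - ⟪e, x⟫_ℝ • e := ⟨_, rfl⟩
  have hey : ⟪e, y⟫_ℝ = 0 := by rw [hy, inner_sub_right, real_inner_smul_right, he]; ring
  have hx : x = ⟪e, x⟫_ℝ • e + y := by rw [hy]; abel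
  generalize ⟪e, x⟫_ℝ = t at hx ⊢
  subst hx
  have hyy := h.mul_eq_neg_inner_smul he hee (hV y hey) (hV y hey)
  simp only [map_add, map_smul, LinearMap.add_apply, LinearMap.smul_apply, hee, hV y hey,
    h.comm y e, hyy, inner_add_left, inner_add_right, real_inner_smul_left, real_inner_smul_right,
    inner_neg_left, he, hey, real_inner_comm e y]
  ring

theorem exists_mem_orthogonalGroup {n : ℕ} (i₀ : Fin n) (e : EuclideanSpace ℝ (Fin n))
    (he : inner ℝ e e = 1) : ∃ U ∈ Matrix.orthogonalGroup (Fin n) ℝ,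
      ∀ x : EuclideanSpace ℝ (Fin n), U.mulVec x i₀ = inner ℝ e x ∧
        ∑ i, U.mulVec x i ^ 2 = inner ℝ x x := by
  have hon : Orthonormal ℝ (({i₀} : Set (Fin n)).domRestrict fun _ => e) := by
    rw [orthonormal_iff_ite]
    intro i j
    rw [if_pos (Subsingleton.elim i j)]
    exact he
  obtain ⟨b, hb⟩ := hon.exists_orthonormalBasis_extension_of_card_eq (by simp)
  have hU : ∀ (x : EuclideanSpace ℝ (Fin n)) i,
      (Matrix.of fun i j => b i j).mulVec x i = inner ℝ (b i) x := by
    intro x i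
    simp [Matrix.mulVec, dotProduct, PiLp.inner_apply, mul_comm]
  refine ⟨Matrix.of fun i j => b i j, ?_, fun x => ⟨?_, ?_⟩⟩
  · rw [Matrix.mem_orthogonalGroup_iff]
    ext i j
    have := orthonormal_iff_ite.1 b.orthonormal i j
    rw [Matrix.one_apply, ← this]
    simp [Matrix.mul_apply, PiLp.inner_apply, mul_comm]
  · rw [hU, hb i₀ rfl]
  · simp only [hU]
    rw [b.sum_sq_inner_right, real_inner_self_eq_norm_sq]

/-- **Generalized Cartan theorem (Tkachev).** Any homogeneous cubic polynomial `f` on `ℝⁿ`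
(`n ≥ 2`) satisfying the eiconal equation `|∇f(x)|² = 9|x|⁴` is either rotationally
equivalent to `xₙ³ − 3xₙ(x₁² + ⋯ + x_{n−1}²)`, or `n ∈ {5, 8, 14, 26}` and `f` is
harmonic. -/
theorem cartan_eiconal_cubics (n : ℕ) (hn : 2 ≤ n) (f : MvPolynomial (Fin n) ℝ)
    (hcubic : ∀ (t : ℝ) (x : Fin n → ℝ), eval (t • x) f = t ^ 3 * eval x f)
    (heiconal : ∀ x : Fin n → ℝ,
      ∑ i, (eval x (pderiv i f)) ^ 2 = 9 * (∑ i, x i ^ 2) ^ 2) :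
    (∃ U : Matrix (Fin n) (Fin n) ℝ, U ∈ Matrix.orthogonalGroup (Fin n) ℝ ∧
      ∀ x : Fin n → ℝ, eval x f =
        eval (U.mulVec x)
          ((X (⟨n - 1, by omega⟩ : Fin n)) ^ 3 -
            3 * X (⟨n - 1, by omega⟩ : Fin n) *
              ∑ i : Fin (n - 1), (X (⟨i.1, by omega⟩ : Fin n)) ^ 2)) ∨
    (n ∈ ({5, 8, 14, 26} : Set ℕ) ∧ ∑ i, pderiv i (pderiv i f) = 0) := by
  have hf := isHomogeneous_of_eval_smul hcubic
  have hM := isEiconalProduct_cubicProduct hf heiconal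
  have : Nontrivial (EuclideanSpace ℝ (Fin n)) := by
    refine Module.nontrivial_of_finrank_pos (R := ℝ) ?_
    rw [finrank_euclideanSpace_fin]
    omega
  rcases hM.reducible_or_harmonic with ⟨e, he, hee, hV⟩ | ⟨hn', ht⟩
  · left
    obtain ⟨k, rfl⟩ : ∃ k, n = k + 1 := ⟨n - 1, by omega⟩
    obtain ⟨U, hU, hUx⟩ := exists_mem_orthogonalGroup (Fin.last k) e he
    refine ⟨U, hU, fun x => ?_⟩
    have h1 := eval_eq_inner hf (WithLp.toLp 2 x)
    obtain ⟨h2, h3⟩ := hUx (WithLp.toLp 2 x)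
    rw [hM.inner_mul_self_eq he hee hV, ← h2, ← h3, Fin.sum_univ_castSucc] at h1
    change eval x f = eval (U.mulVec x)
      (X (Fin.last k) ^ 3 - 3 * X (Fin.last k) * ∑ i : Fin k, X i.castSucc ^ 2)
    simp only [map_sub, map_mul, map_pow, eval_X, map_sum, map_ofNat]
    rw [show eval x f = _ from h1]
    ring
  · right
    rw [finrank_euclideanSpace_fin] at hn'
    exact ⟨hn', sum_pderiv_pderiv_eq_zero hf ht⟩
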